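/- arXiv:1404.4183 — 3 statements merged into one kernel-verified Lean document; each statement's English description precedes it below -/
import Mathlib

section
/- For every integer k and every m : Fin p → ℤ such that ∑ᵢ mᵢ² ≤ k², k − ∑ᵢ mᵢλᵢ > 0, and 3k − ∑ᵢ mᵢ ≥ 2, one has (k − ∑ᵢ mᵢλᵢ)/(3k − ∑ᵢ mᵢ) ≥ (1 − κ)/(3 + √p). Consequently, the infimum d of the set of ratios {(k − ∑ᵢ mᵢλᵢ)/(3k − ∑ᵢ mᵢ) : k ∈ ℤ, m : Fin p → ℤ, ∑ᵢ mᵢ² ≤ k², k − ∑ᵢ mᵢλᵢ > 0, 3k − ∑ᵢ mᵢ ≥ 2} satisfies d ≥ (1 − κ)/(3 + √p). -/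
/-- Cauchy–Schwarz for a vector whose Euclidean norm is at most `|k|`. -/
theorem sum_mul_le_abs_mul_sqrt {ι : Type*} [Fintype ι] {k : ℝ} {x : ι → ℝ}
    (hx : ∑ i, x i ^ 2 ≤ k ^ 2) (y : ι → ℝ) :
    ∑ i, x i * y i ≤ |k| * Real.sqrt (∑ i, y i ^ 2) := by
  refine (Real.sum_mul_le_sqrt_mul_sqrt Finset.univ x y).trans ?_
  gcongr
  rw [← Real.sqrt_sq_eq_abs]
  exact Real.sqrt_le_sqrt hx

/-- The lower bound on the ratio of area to first Chern number, over the reals. -/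
theorem le_area_div_chern {ι : Type*} [Fintype ι] {lam x : ι → ℝ} {k : ℝ}
    (hκ : Real.sqrt (∑ i, lam i ^ 2) < 1) (hx : ∑ i, x i ^ 2 ≤ k ^ 2)
    (harea : 0 < k - ∑ i, x i * lam i) (hchern : 0 < 3 * k - ∑ i, x i) :
    (1 - Real.sqrt (∑ i, lam i ^ 2)) / (3 + Real.sqrt (Fintype.card ι)) ≤
      (k - ∑ i, x i * lam i) / (3 * k - ∑ i, x i) := by
  have h₁ := sum_mul_le_abs_mul_sqrt hx lam
  have h₂ := sum_mul_le_abs_mul_sqrt hx (fun i => -lam i)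
  have h₃ := sum_mul_le_abs_mul_sqrt hx (fun _ => -1)
  simp only [mul_neg, Finset.sum_neg_distrib, neg_sq, mul_one, one_pow, Finset.sum_const,
    Finset.card_univ, nsmul_eq_mul] at h₂ h₃
  have hk : 0 ≤ k := by
    by_contra! hk
    rw [abs_of_neg hk] at h₂
    nlinarith
  rw [abs_of_nonneg hk] at h₁ h₃
  have hs := Real.sqrt_nonneg (Fintype.card ι : ℝ)
  rw [div_le_div_iff₀ (by positivity) hchern]
  calc _ ≤ (1 - Real.sqrt (∑ i, lam i ^ 2)) * (k * (3 + Real.sqrt (Fintype.card ι))) := by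
        gcongr
        · linarith
    _ = (k * (1 - Real.sqrt (∑ i, lam i ^ 2))) * (3 + Real.sqrt (Fintype.card ι)) := by ring
    _ ≤ _ := by
        gcongr
        linarith

/-- Biran-type lower bound for the ratio `Ω(B)/c₁(B)` on the `p`-fold blow-up of `ℙ²`,
and the resulting lower bound on the infimum `d_Ω`. -/
theorem stmt_0 (p : ℕ) (lam : Fin p → ℝ) (hlam : ∀ i, 0 < lam i)
    (hκ : Real.sqrt (∑ i, lam i ^ 2) < 1) :
    (∀ (k : ℤ) (m : Fin p → ℤ),
        (∑ i, m i ^ 2) ≤ k ^ 2 →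
        0 < (k : ℝ) - ∑ i, (m i : ℝ) * lam i →
        2 ≤ 3 * k - ∑ i, m i →
        ((k : ℝ) - ∑ i, (m i : ℝ) * lam i) / ((3 * k - ∑ i, m i : ℤ) : ℝ) ≥
          (1 - Real.sqrt (∑ i, lam i ^ 2)) / (3 + Real.sqrt p)) ∧
    (1 - Real.sqrt (∑ i, lam i ^ 2)) / (3 + Real.sqrt p) ≤
      sInf {r : ℝ | ∃ (k : ℤ) (m : Fin p → ℤ),
        (∑ i, m i ^ 2) ≤ k ^ 2 ∧
        0 < (k : ℝ) - ∑ i, (m i : ℝ) * lam i ∧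
        2 ≤ 3 * k - ∑ i, m i ∧
        r = ((k : ℝ) - ∑ i, (m i : ℝ) * lam i) / ((3 * k - ∑ i, m i : ℤ) : ℝ)} := by
  have bound : ∀ (k : ℤ) (m : Fin p → ℤ), (∑ i, m i ^ 2) ≤ k ^ 2 →
      0 < (k : ℝ) - ∑ i, (m i : ℝ) * lam i → 2 ≤ 3 * k - ∑ i, m i →
      (1 - Real.sqrt (∑ i, lam i ^ 2)) / (3 + Real.sqrt p) ≤
        ((k : ℝ) - ∑ i, (m i : ℝ) * lam i) / ((3 * k - ∑ i, m i : ℤ) : ℝ) := by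
    intro k m hm harea hchern
    have hm' : ∑ i, (m i : ℝ) ^ 2 ≤ (k : ℝ) ^ 2 := by exact_mod_cast hm
    have hchern' : (0 : ℝ) < 3 * k - ∑ i, (m i : ℝ) := by
      exact_mod_cast two_pos.trans_le hchern
    simpa using le_area_div_chern hκ hm' harea hchern'
  refine ⟨bound, le_csInf ⟨_, 1, 0, by simp, by simp, by simp, rfl⟩ ?_⟩
  rintro r ⟨k, m, hm, harea, hchern, rfl⟩
  exact bound k m hm harea hchern
end

section
/- Let a, b, α, β be real numbers with 0 < α < a, 0 < β < b, a < α + β and b < α + β, and let C := ([0,a] × {0}) ∪ ({0} × [0,b]) ⊆ ℝ² be the cross along the axes. Then the convex hull of {(0,0), (a,0), (0,b), (α,β)} equals the union over all x ∈ C of the closed segments [x, (α,β)] joining x to the apex (α,β). (That is, the pseudo-ball polytope is exactly swept out by the straight-line trajectories of the Liouville flow joining points of the cross to the point (α,β).) -/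
open Set

/-- A point of the triangle with vertices `(0,0)`, `(a,0)`, `(α,β)` lies on a segment
joining a point of the base `[0,a] × {0}` to the apex `(α,β)`. -/
lemma exists_base_point_of_mem_triangle {a α β x y : ℝ} (hβ : 0 < β) (ha : 0 < a)
    (hy : 0 ≤ y) (hleft : α * y ≤ β * x) (hright : β * x + (a - α) * y ≤ a * β) :
    ∃ c ∈ Icc (0 : ℝ) a, ∃ s ∈ Icc (0 : ℝ) 1, (1 - s) * c + s * α = x ∧ s * β = y := by
  obtain ⟨s, rfl⟩ : ∃ s, y = s * β := ⟨y / β, by field_simp⟩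
  have hs : 0 ≤ s := nonneg_of_mul_nonneg_left hy hβ
  have hx : s * α ≤ x := le_of_mul_le_mul_left (by linarith) hβ
  have hxa : x - s * α ≤ a * (1 - s) := le_of_mul_le_mul_left (by linarith) hβ
  have hs1 : s ≤ 1 := by
    have : 0 ≤ 1 - s := nonneg_of_mul_nonneg_right (by linarith : 0 ≤ a * (1 - s)) ha
    linarith
  rcases hs1.eq_or_lt with rfl | hlt
  · exact ⟨0, ⟨le_rfl, ha.le⟩, 1, by simp, by linarith, rfl⟩
  · have hpos : 0 < 1 - s := by linarith
    refine ⟨(x - s * α) / (1 - s), ⟨div_nonneg (by linarith) hpos.le, ?_⟩, s, ⟨hs, hs1⟩, ?_, rfl⟩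
    · rwa [div_le_iff₀ hpos]
    · rw [mul_div_cancel₀ _ hpos.ne']
      ring

/-- A half-plane of `ℝ × ℝ` given by a linear inequality in coordinates is convex. -/
lemma convex_setOf_mul_fst_add_mul_snd_le (p q r : ℝ) :
    Convex ℝ {z : ℝ × ℝ | p * z.1 + q * z.2 ≤ r} :=
  convex_halfSpace_le (p • LinearMap.fst ℝ ℝ ℝ + q • LinearMap.snd ℝ ℝ ℝ).isLinear r

/-- The pseudo-ball polytope satisfies the four inequalities defining its edges. -/
lemma convexHull_pseudoBall_subset {a b α β : ℝ} (hα : 0 < α) (hβ : 0 < β) (ha : α < a)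
    (hb : β < b) (hab : a < α + β) (hba : b < α + β) :
    convexHull ℝ ({((0 : ℝ), (0 : ℝ)), (a, 0), (0, b), (α, β)} : Set (ℝ × ℝ)) ⊆
      {z | -1 * z.1 + 0 * z.2 ≤ 0} ∩ {z | 0 * z.1 + -1 * z.2 ≤ 0} ∩
        {z | β * z.1 + (a - α) * z.2 ≤ a * β} ∩ {z | (b - β) * z.1 + α * z.2 ≤ b * α} := by
  refine convexHull_min ?_ ((((convex_setOf_mul_fst_add_mul_snd_le _ _ _).inter
    (convex_setOf_mul_fst_add_mul_snd_le _ _ _)).inter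
    (convex_setOf_mul_fst_add_mul_snd_le _ _ _)).inter
    (convex_setOf_mul_fst_add_mul_snd_le _ _ _))
  have h₁ : (a - α) * b ≤ a * β := by
    nlinarith [mul_pos (sub_pos.2 ha) (sub_pos.2 hba), mul_pos hα (sub_pos.2 hab)]
  have h₂ : (b - β) * a ≤ b * α := by linarith
  rintro z (rfl | rfl | rfl | rfl) <;>
    simp only [mem_inter_iff, mem_ofPred_eq] <;>
    refine ⟨⟨⟨?_, ?_⟩, ?_⟩, ?_⟩ <;> nlinarith

/-- The pseudo-ball polytope `Q(a,b,α,β)` is swept out by the closed segments joining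
points of the cross `([0,a]×{0}) ∪ ({0}×[0,b])` to the apex `(α,β)`. -/
theorem stmt_9 (a b α β : ℝ) (hα : 0 < α) (hβ : 0 < β) (ha : α < a) (hb : β < b)
    (hab : a < α + β) (hba : b < α + β) :
    convexHull ℝ ({((0 : ℝ), (0 : ℝ)), (a, 0), (0, b), (α, β)} : Set (ℝ × ℝ))
      = ⋃ x ∈ (Set.Icc (0 : ℝ) a ×ˢ ({0} : Set ℝ)) ∪ (({0} : Set ℝ) ×ˢ Set.Icc (0 : ℝ) b),
          segment ℝ x (α, β) := by
  have ha₀ : 0 < a := hα.trans ha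
  have hb₀ : 0 < b := hβ.trans hb
  apply Subset.antisymm
  · rintro ⟨x, y⟩ hz
    obtain ⟨⟨⟨hx, hy⟩, h₁⟩, h₂⟩ := convexHull_pseudoBall_subset hα hβ ha hb hab hba hz
    simp only [mem_ofPred_eq] at hx hy h₁ h₂
    simp only [mem_iUnion]
    rcases le_total (α * y) (β * x) with h | h
    · obtain ⟨c, hc, s, hs, hsx, hsy⟩ :=
        exists_base_point_of_mem_triangle hβ ha₀ (by linarith) h h₁
      exact ⟨(c, 0), Or.inl ⟨hc, rfl⟩, 1 - s, s, by linarith [hs.2], hs.1, by ring,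
        by simp [hsx, hsy]⟩
    · obtain ⟨c, hc, s, hs, hsy, hsx⟩ :=
        exists_base_point_of_mem_triangle hα hb₀ (by linarith) h (by linarith)
      exact ⟨(0, c), Or.inr ⟨rfl, hc⟩, 1 - s, s, by linarith [hs.2], hs.1, by ring,
        by simp [hsx, hsy]⟩
  · have hconv := convex_convexHull ℝ
      ({((0 : ℝ), (0 : ℝ)), (a, 0), (0, b), (α, β)} : Set (ℝ × ℝ))
    have hsub := subset_convexHull ℝ
      ({((0 : ℝ), (0 : ℝ)), (a, 0), (0, b), (α, β)} : Set (ℝ × ℝ))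
    refine iUnion₂_subset fun z hz => hconv.segment_subset ?_ (hsub (by simp))
    rcases hz with ⟨hc, h0⟩ | ⟨h0, hc⟩
    · refine hconv.segment_subset (x := (0, 0)) (y := (a, 0)) (hsub (by simp)) (hsub (by simp)) ?_
      rw [← Prod.image_mk_segment_left, segment_eq_Icc ha₀.le]
      exact ⟨z.1, hc, Prod.ext rfl h0.symm⟩
    · refine hconv.segment_subset (x := (0, 0)) (y := (0, b)) (hsub (by simp)) (hsub (by simp)) ?_
      rw [← Prod.image_mk_segment_right, segment_eq_Icc hb₀.le]
      exact ⟨z.2, hc, Prod.ext h0.symm rfl⟩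
end

section
/- Let δ > 0, let m, N ∈ ℕ, let v : Fin m → ℝ with vᵢ ≥ 0 for all i, and let c : Fin N → ℝ with 0 < c_j ≤ δ for all j, such that ∑ᵢ vᵢ = ∑ⱼ c_j. Then there exists a function f : Fin N → Fin m such that for every i ∈ Fin m, |∑_{j : f(j) = i} c_j − vᵢ| ≤ δ. -/
open Finset

/-- Items of size at most `δ` have a subcollection whose total size overshoots any given
nonnegative target, not exceeding the total of all items, by at most `δ`. -/
theorem exists_subset_le_sum_le_add {κ : Type*} [DecidableEq κ] {δ a : ℝ} (hδ : 0 ≤ δ)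
    (ha : 0 ≤ a) {c : κ → ℝ} (hc : ∀ j, c j ≤ δ) (s : Finset κ) (has : a ≤ ∑ j ∈ s, c j) :
    ∃ t ⊆ s, a ≤ ∑ j ∈ t, c j ∧ ∑ j ∈ t, c j ≤ a + δ := by
  induction s using Finset.induction_on with
  | empty => exact ⟨∅, subset_rfl, has, by simp only [sum_empty]; positivity⟩
  | insert j s hj ih =>
    rcases le_or_gt a (∑ j ∈ s, c j) with h | h
    · obtain ⟨t, hts, ht⟩ := ih h
      exact ⟨t, hts.trans (subset_insert j s), ht⟩
    · refine ⟨insert j s, subset_rfl, has, ?_⟩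
      rw [sum_insert hj]
      linarith [hc j]

/-- If pieces of size `v i` have total size exceeding the total size of items of size in
`(0, δ]` by `e ∈ [0, δ]`, the items can be distributed among the pieces with an error of at
most `δ` for each piece. -/
theorem exists_assignment_abs_sum_sub_le {ι κ : Type*} [DecidableEq ι] [DecidableEq κ]
    [Nonempty ι] {δ : ℝ} {v : ι → ℝ} (hv : ∀ i, 0 ≤ v i) {c : κ → ℝ}
    (hc : ∀ j, 0 < c j ∧ c j ≤ δ) (p : Finset ι) (s : Finset κ) {e : ℝ} (he : 0 ≤ e)
    (heδ : e ≤ δ) (hsum : ∑ i ∈ p, v i = ∑ j ∈ s, c j + e) :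
    ∃ f : κ → ι, (∀ j ∈ s, f j ∈ p) ∧ ∀ i ∈ p, |∑ j ∈ s with f j = i, c j - v i| ≤ δ := by
  induction p using Finset.induction_on generalizing s e with
  | empty =>
    have hs : s = ∅ := by
      by_contra hne
      have := sum_pos (fun j _ => (hc j).1) (nonempty_iff_ne_empty.2 hne)
      rw [sum_empty] at hsum
      linarith
    subst hs
    exact ⟨fun _ => Classical.arbitrary ι, by simp, by simp⟩
  | insert a p hap ih =>
    rw [sum_insert hap] at hsum
    obtain ⟨t, hts, ht₁, ht₂⟩ :
        ∃ t ⊆ s, v a ≤ ∑ j ∈ t, c j + e ∧ ∑ j ∈ t, c j + e ≤ v a + δ := by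
      rcases le_total (v a) e with h | h
      · exact ⟨∅, empty_subset s, by simpa using h, by simpa using by linarith [hv a]⟩
      · have := sum_nonneg fun i (_ : i ∈ p) => hv i
        obtain ⟨t, hts, h₁, h₂⟩ := exists_subset_le_sum_le_add (he.trans heδ)
          (sub_nonneg.2 h) (fun j => (hc j).2) s (by linarith)
        exact ⟨t, hts, by linarith, by linarith⟩
    have hsplit := sum_sdiff (f := c) hts
    obtain ⟨f, hfp, hf⟩ := ih (s \ t) (e := ∑ j ∈ t, c j + e - v a) (by linarith)
      (by linarith) (by linarith)
    refine ⟨fun j => if j ∈ t then a else f j, fun j hj => ?_, fun i hi => ?_⟩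
    · by_cases hjt : j ∈ t
      · simp [hjt]
      · simpa [hjt] using Or.inr (hfp j (mem_sdiff.2 ⟨hj, hjt⟩))
    · rcases mem_insert.1 hi with rfl | hip
      · have : {j ∈ s | (if j ∈ t then i else f j) = i} = t := by
          ext j
          have := hfp j
          have := @hts j
          grind
        rw [this, abs_le]
        constructor <;> linarith
      · have : {j ∈ s | (if j ∈ t then a else f j) = i} = {j ∈ s \ t | f j = i} := by
          ext j
          grind
        rw [this]
        exact hf i hip

/-- Bookkeeping lemma: balls of individual volume at most `δ` whose total volume equals
the total volume of `m` pieces can be partitioned into `m` groups, the total volume of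
the `i`-th group differing from the volume `vᵢ` of the `i`-th piece by at most `δ`. -/
theorem stmt_11 (δ : ℝ) (hδ : 0 < δ) (m N : ℕ) (v : Fin m → ℝ) (hv : ∀ i, 0 ≤ v i)
    (c : Fin N → ℝ) (hc : ∀ j, 0 < c j ∧ c j ≤ δ)
    (hsum : ∑ i, v i = ∑ j, c j) :
    ∃ f : Fin N → Fin m, ∀ i,
      |(∑ j ∈ Finset.univ.filter fun j => f j = i, c j) - v i| ≤ δ := by
  rcases isEmpty_or_nonempty (Fin m) with hm | hm
  · have hN : IsEmpty (Fin N) := by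
      by_contra hne
      rw [not_isEmpty_iff] at hne
      have := sum_pos (fun j _ => (hc j).1) (univ_nonempty (α := Fin N))
      rw [univ_eq_empty, sum_empty] at hsum
      linarith
    exact ⟨isEmptyElim, isEmptyElim⟩
  · obtain ⟨f, -, hf⟩ := exists_assignment_abs_sum_sub_le hv hc univ univ le_rfl hδ.le
      (by rw [hsum, add_zero])
    exact ⟨f, fun i => hf i (mem_univ i)⟩
end
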